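/- arXiv:2601.01447 — 2 statements merged into one kernel-verified Lean document; each statement's English description precedes it below -/
import Mathlib

section
/- (Analytic part of Theorem 1.) Let κ ∈ (0,1], σ > 0, c > 0, λ > 0 and a, r ∈ ℝ be such that γ := 2((a−r)κ + r)/(κ²σ²) > 1, and let ν be a probability measure on (0,∞) with finite mean. Then there exists a function Φ, continuous on [0,∞) and twice continuously differentiable on (0,∞), with Φ(0) = 0 and Φ(u) → 1 as u → ∞, satisfying for all u > 0 the integro-differential equation (1/2) κ²σ² u² Φ''(u) + ((a−r)κ + r) u Φ'(u) = c Φ'(u) − λ ∫_{(0,∞)} (Φ(u+y) − Φ(u)) ν(dy); moreover there exists a finite constant C > 0 such that u^{γ−1} (1 − Φ(u)) → C as u → ∞. -/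
open MeasureTheory Set Filter Topology

namespace RuinIDE

/-- The integrating factor of the differential part `u² g' + (γ u - k) g`. -/
noncomputable def weight (γ k u : ℝ) : ℝ := u ^ γ * Real.exp (k / u)

/-- The candidate supersolution. -/
noncomputable def barrier (γ ε B u : ℝ) : ℝ := (u + ε) ^ (-γ) * Real.exp (B / (u + ε))

/-- The jump term, written in terms of the density `f`. -/
noncomputable def jumpTerm (ν : Measure ℝ) (f : ℝ → ENNReal) (u : ℝ) : ENNReal :=
  ∫⁻ y, (∫⁻ v in Ioc u (u + y), f v) ∂ν

lemma weight_pos {γ k u : ℝ} (hu : 0 < u) : 0 < weight γ k u := by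
  unfold weight; positivity

lemma barrier_pos {γ ε B u : ℝ} (hu : 0 < u) (hε : 0 < ε) : 0 < barrier γ ε B u := by
  unfold barrier; positivity

lemma jumpTerm_mono (ν : Measure ℝ) : Monotone (jumpTerm ν) := fun _ _ h _ =>
  lintegral_mono fun _ => lintegral_mono h

lemma lintegral_Ioi_ofReal_neg_deriv {f f' : ℝ → ℝ} {a L : ℝ}
    (hf : ∀ x ∈ Ici a, HasDerivAt f (f' x) x) (hneg : ∀ x ∈ Ioi a, f' x ≤ 0)
    (hL : Tendsto f atTop (𝓝 L)) :
    ∫⁻ x in Ioi a, ENNReal.ofReal (-f' x) = ENNReal.ofReal (f a - L) := by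
  have hint := integrableOn_Ioi_deriv_of_nonpos' hf hneg hL
  rw [← ofReal_integral_eq_lintegral_ofReal (f := fun x => -f' x) hint.neg]
  · rw [integral_neg, integral_Ioi_of_hasDerivAt_of_nonpos' hf hneg hL, neg_sub]
  · filter_upwards [ae_restrict_mem measurableSet_Ioi] with x hx
    simpa using hneg x hx

lemma barrier_antitoneOn {γ ε B : ℝ} (hγ : 1 < γ) (hε : 0 < ε) (hB : 0 ≤ B) :
    AntitoneOn (barrier γ ε B) (Ioi 0) := by
  intro u hu v hv huv
  have hu' : 0 < u := hu
  unfold barrier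
  apply mul_le_mul
  · exact Real.rpow_le_rpow_of_nonpos (by linarith) (by linarith) (by linarith)
  · gcongr
  · positivity
  · positivity

lemma lintegral_Ioi_barrier_le {γ ε B u : ℝ} (hγ : 1 < γ) (hε : 0 < ε) (hB : 0 ≤ B)
    (hu : 0 < u) :
    ∫⁻ v in Ioi u, ENNReal.ofReal (barrier γ ε B v) ≤
      ENNReal.ofReal (barrier γ ε B u * ((u + ε) / (γ - 1))) := by
  have hγ' : 0 < γ - 1 := by linarith
  have hd : ∀ x ∈ Ici u, HasDerivAt
      (fun v : ℝ => Real.exp (B / (u + ε)) / (γ - 1) * (v + ε) ^ (-(γ - 1)))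
      (-((x + ε) ^ (-γ) * Real.exp (B / (u + ε)))) x := by
    intro x hx
    have hx' : 0 < x + ε := by have : u ≤ x := hx; linarith
    have h := (((hasDerivAt_id x).add_const ε).rpow_const (p := -(γ - 1))
      (Or.inl hx'.ne')).const_mul (Real.exp (B / (u + ε)) / (γ - 1))
    refine h.congr_deriv ?_
    have : -(γ - 1) - 1 = -γ := by ring
    simp only [id, this]
    field_simp
  have hlim : Tendsto
      (fun v : ℝ => Real.exp (B / (u + ε)) / (γ - 1) * (v + ε) ^ (-(γ - 1))) atTop (𝓝 0) := by
    have := ((tendsto_rpow_neg_atTop hγ').comp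
      (tendsto_atTop_add_const_right atTop ε tendsto_id)).const_mul
        (Real.exp (B / (u + ε)) / (γ - 1))
    simpa using this
  have key := lintegral_Ioi_ofReal_neg_deriv hd (fun x hx => by
    have hx' : 0 < x + ε := by have : u < x := hx; linarith
    have : 0 < (x + ε) ^ (-γ) * Real.exp (B / (u + ε)) := by positivity
    linarith) hlim
  calc _ ≤ ∫⁻ x in Ioi u, ENNReal.ofReal (-(-((x + ε) ^ (-γ) * Real.exp (B / (u + ε))))) := by
        refine setLIntegral_mono' measurableSet_Ioi fun x hx => ENNReal.ofReal_le_ofReal ?_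
        have hx' : u < x := hx
        have hx2 : 0 < x + ε := by linarith
        rw [neg_neg]
        unfold barrier
        gcongr
    _ = _ := key
    _ ≤ _ := by
        refine ENNReal.ofReal_le_ofReal (le_of_eq ?_)
        have h1 : (u + ε) ^ (-(γ - 1)) = (u + ε) ^ (-γ) * (u + ε) := by
          rw [show -(γ - 1) = -γ + 1 by ring, Real.rpow_add_one (by positivity)]
        unfold barrier
        rw [h1]; ring

lemma jumpTerm_barrier_le_mean {γ ε B u : ℝ} {ν : Measure ℝ} (hν : ∀ᵐ y ∂ν, 0 < y)
    (hmean : Integrable (fun y => y) ν) (hγ : 1 < γ) (hε : 0 < ε) (hB : 0 ≤ B) (hu : 0 < u) :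
    jumpTerm ν (fun v => ENNReal.ofReal (barrier γ ε B v)) u ≤
      ENNReal.ofReal (barrier γ ε B u * ∫ y, y ∂ν) := by
  rw [ENNReal.ofReal_mul (barrier_pos hu hε).le,
    ofReal_integral_eq_lintegral_ofReal hmean (hν.mono fun y hy => hy.le),
    ← lintegral_const_mul _ (by fun_prop)]
  unfold jumpTerm
  refine lintegral_mono fun y => ?_
  calc _ ≤ ∫⁻ v in Ioc u (u + y), ENNReal.ofReal (barrier γ ε B u) := by
        refine setLIntegral_mono' measurableSet_Ioc fun v hv => ENNReal.ofReal_le_ofReal ?_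
        exact barrier_antitoneOn hγ hε hB hu (hu.trans hv.1) hv.1.le
    _ = _ := by simp

lemma jumpTerm_barrier_le_tail {γ ε B u : ℝ} {ν : Measure ℝ} [IsProbabilityMeasure ν]
    (hγ : 1 < γ) (hε : 0 < ε) (hB : 0 ≤ B) (hu : 0 < u) :
    jumpTerm ν (fun v => ENNReal.ofReal (barrier γ ε B v)) u ≤
      ENNReal.ofReal (barrier γ ε B u * ((u + ε) / (γ - 1))) := by
  unfold jumpTerm
  calc _ ≤ ∫⁻ _, ENNReal.ofReal (barrier γ ε B u * ((u + ε) / (γ - 1))) ∂ν :=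
        lintegral_mono fun y => (lintegral_mono_set Ioc_subset_Ioi_self).trans
          (lintegral_Ioi_barrier_le hγ hε hB hu)
    _ = _ := by simp

/-- Minus `u²` times the logarithmic derivative of `weight * barrier`. -/
noncomputable def rate (γ k ε B u : ℝ) : ℝ :=
  k - γ * u * ε / (u + ε) + B * u ^ 2 / (u + ε) ^ 2

lemma hasDerivAt_weight {γ k u : ℝ} (hu : 0 < u) :
    HasDerivAt (weight γ k) (weight γ k u * (γ / u - k / u ^ 2)) u := by
  have h := (Real.hasDerivAt_rpow_const (p := γ) (Or.inl hu.ne')).mul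
    ((hasDerivAt_inv hu.ne').const_mul k).exp
  refine h.congr_deriv ?_
  rw [Real.rpow_sub_one hu.ne']
  simp only [weight, div_eq_mul_inv]
  ring

lemma hasDerivAt_barrier {γ ε B u : ℝ} (hu : 0 < u) (hε : 0 < ε) :
    HasDerivAt (barrier γ ε B)
      (barrier γ ε B u * (-γ / (u + ε) - B / (u + ε) ^ 2)) u := by
  have h0 : 0 < u + ε := by positivity
  have hi := (hasDerivAt_id u).add_const ε
  have h := (hi.rpow_const (p := -γ) (Or.inl h0.ne')).mul ((hi.inv h0.ne').const_mul B).exp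
  refine h.congr_deriv ?_
  simp only [id, barrier]
  rw [Real.rpow_sub_one h0.ne']
  simp only [div_eq_mul_inv, Pi.inv_apply]
  ring

lemma hasDerivAt_weight_mul_barrier {γ k ε B u : ℝ} (hu : 0 < u) (hε : 0 < ε) :
    HasDerivAt (fun x => weight γ k x * barrier γ ε B x)
      (-(weight γ k u * barrier γ ε B u * rate γ k ε B u / u ^ 2)) u := by
  refine ((hasDerivAt_weight hu).mul (hasDerivAt_barrier hu hε)).congr_deriv ?_
  have h0 : 0 < u + ε := by positivity
  unfold rate
  field_simp
  ring

lemma tendsto_weight_mul_barrier {γ k ε B : ℝ} (hε : 0 < ε) :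
    Tendsto (fun x => weight γ k x * barrier γ ε B x) atTop (𝓝 1) := by
  have hs : Tendsto (fun x : ℝ => x + ε) atTop atTop :=
    tendsto_atTop_add_const_right atTop ε tendsto_id
  have h1 : Tendsto (fun x : ℝ => 1 - ε / (x + ε)) atTop (𝓝 1) := by
    simpa using (hs.const_div_atTop ε).const_sub 1
  have h2 := (h1.rpow_const (p := γ) (Or.inl one_ne_zero)).mul
    ((((tendsto_id (α := ℝ)).const_div_atTop k).add (hs.const_div_atTop B)).rexp)
  simp only [Real.one_rpow, add_zero, Real.exp_zero, mul_one] at h2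
  refine h2.congr' ?_
  filter_upwards [eventually_gt_atTop 0] with x hx
  have h0 : 0 < x + ε := by positivity
  have : 1 - ε / (x + ε) = x / (x + ε) := by field_simp; ring
  rw [this, Real.div_rpow hx.le h0.le, Real.exp_add]
  unfold weight barrier
  rw [Real.rpow_neg h0.le]
  simp only [id]
  ring

/-- The integral operator whose fixed points solve the integro-differential equation. -/
noncomputable def solOp (γ k l : ℝ) (ν : Measure ℝ) : (ℝ → ENNReal) →o (ℝ → ENNReal) where
  toFun f u := ENNReal.ofReal (weight γ k u)⁻¹ *
    (1 + ∫⁻ s in Ioi u, ENNReal.ofReal (l / s ^ 2 * weight γ k s) * jumpTerm ν f s)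
  monotone' f g h u := by
    dsimp only
    gcongr
    exact jumpTerm_mono ν h _

lemma solOp_apply (γ k l : ℝ) (ν : Measure ℝ) (f : ℝ → ENNReal) (u : ℝ) :
    solOp γ k l ν f u = ENNReal.ofReal (weight γ k u)⁻¹ *
      (1 + ∫⁻ s in Ioi u, ENNReal.ofReal (l / s ^ 2 * weight γ k s) * jumpTerm ν f s) := rfl

lemma solOp_barrier_le {γ k l ε B : ℝ} {ν : Measure ℝ} (hε : 0 < ε)
    (hrate : ∀ u, 0 < u → 0 ≤ rate γ k ε B u)
    (hjump : ∀ u, 0 < u → ENNReal.ofReal l *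
      jumpTerm ν (fun v => ENNReal.ofReal (barrier γ ε B v)) u ≤
        ENNReal.ofReal (barrier γ ε B u * rate γ k ε B u))
    {u : ℝ} (hu : 0 < u) :
    solOp γ k l ν (fun v => ENNReal.ofReal (barrier γ ε B v)) u ≤
      ENNReal.ofReal (barrier γ ε B u) := by
  have hψ : ∀ s, 0 < s → 0 ≤ weight γ k s * barrier γ ε B s * rate γ k ε B s / s ^ 2 :=
    fun s hs => by
      have := weight_pos (γ := γ) (k := k) hs
      have := barrier_pos (γ := γ) (B := B) hs hε
      have := hrate s hs
      positivity
  have key := lintegral_Ioi_ofReal_neg_deriv (a := u)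
    (fun x hx => hasDerivAt_weight_mul_barrier (γ := γ) (k := k) (B := B) (hu.trans_le hx) hε)
    (fun x hx => neg_nonpos.2 (hψ x (hu.trans hx))) (tendsto_weight_mul_barrier hε)
  have hanti : 1 ≤ weight γ k u * barrier γ ε B u := by
    have h := antitoneOn_of_deriv_nonpos (D := Ioi 0)
      (f := fun x => weight γ k x * barrier γ ε B x) (convex_Ioi 0)
      (fun x hx => (hasDerivAt_weight_mul_barrier hx hε).continuousAt.continuousWithinAt)
      (fun x hx => (hasDerivAt_weight_mul_barrier (interior_subset hx)
        hε).differentiableAt.differentiableWithinAt)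
      (fun x hx => by
        rw [(hasDerivAt_weight_mul_barrier (interior_subset hx) hε).deriv]
        exact neg_nonpos.2 (hψ x (interior_subset hx)))
    refine le_of_tendsto (tendsto_weight_mul_barrier (γ := γ) (k := k) (B := B) hε) ?_
    filter_upwards [eventually_ge_atTop u] with x hx
    exact h hu (hu.trans_le hx) hx
  have hw := weight_pos (γ := γ) (k := k) hu
  calc _ ≤ ENNReal.ofReal (weight γ k u)⁻¹ * (1 + ∫⁻ s in Ioi u,
        ENNReal.ofReal (-(-(weight γ k s * barrier γ ε B s * rate γ k ε B s / s ^ 2)))) := by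
        rw [solOp_apply]
        gcongr ENNReal.ofReal (weight γ k u)⁻¹ * (1 + ?_)
        refine setLIntegral_mono' measurableSet_Ioi fun s hs => ?_
        have hs' : 0 < s := hu.trans hs
        have hws := weight_pos (γ := γ) (k := k) hs'
        calc _ = ENNReal.ofReal (weight γ k s / s ^ 2) * (ENNReal.ofReal l *
              jumpTerm ν (fun v => ENNReal.ofReal (barrier γ ε B v)) s) := by
              rw [← mul_assoc, ← ENNReal.ofReal_mul (by positivity)]
              congr 2; ring
          _ ≤ ENNReal.ofReal (weight γ k s / s ^ 2) *
              ENNReal.ofReal (barrier γ ε B s * rate γ k ε B s) := by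
              gcongr; exact hjump s hs'
          _ = _ := by
              rw [← ENNReal.ofReal_mul (by positivity)]
              congr 1; ring
    _ = _ := by
        rw [key, ← ENNReal.ofReal_one, ← ENNReal.ofReal_add zero_le_one (by linarith),
          ← ENNReal.ofReal_mul (by positivity)]
        congr 1
        field_simp
        ring

lemma exists_barrier {γ k l : ℝ} (hγ : 1 < γ) (hk : 0 < k) (hl : 0 < l) {ν : Measure ℝ}
    [IsProbabilityMeasure ν] (hν : ∀ᵐ y ∂ν, 0 < y) (hmean : Integrable (fun y => y) ν) :
    ∃ ε B : ℝ, 0 < ε ∧ 0 ≤ B ∧ ∀ u, 0 < u →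
      solOp γ k l ν (fun v => ENNReal.ofReal (barrier γ ε B v)) u ≤
        ENNReal.ofReal (barrier γ ε B u) := by
  have hγ' : 0 < γ - 1 := by linarith
  set m := ∫ y, y ∂ν with hm
  have hm0 : 0 ≤ m := integral_nonneg_of_ae (hν.mono fun y hy => hy.le)
  obtain ⟨ε, hε, hεk⟩ : ∃ ε : ℝ, 0 < ε ∧ γ * ε + l * (2 * ε / (γ - 1)) ≤ k := by
    refine ⟨k / (γ + 2 * l / (γ - 1)), by positivity, le_of_eq ?_⟩
    have : 0 < γ + 2 * l / (γ - 1) := by positivity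
    have h2 : 0 < γ * (γ - 1) + 2 * l := by positivity
    field_simp
  have hB : 0 ≤ 4 * (l * m) := by positivity
  have hfrac : ∀ u, 0 < u → γ * u * ε / (u + ε) ≤ γ * ε := fun u hu => by
    rw [div_le_iff₀ (by positivity)]
    nlinarith [mul_pos (mul_pos (by linarith : 0 < γ) hε) hε]
  have hl2 : 0 ≤ l * (2 * ε / (γ - 1)) := by positivity
  have hlarge : ∀ u, ε ≤ u → l * m ≤ rate γ k ε (4 * (l * m)) u := fun u hu => by
    have h0 : 0 < u := hε.trans_le hu
    have h1 := hfrac u h0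
    have h2 : l * m ≤ 4 * (l * m) * u ^ 2 / (u + ε) ^ 2 := by
      rw [le_div_iff₀ (by positivity)]
      have : (u + ε) ^ 2 ≤ 4 * u ^ 2 := by nlinarith
      nlinarith [mul_nonneg hl.le hm0]
    unfold rate
    linarith
  have hsmall : ∀ u, 0 < u → u ≤ ε →
      l * ((u + ε) / (γ - 1)) ≤ rate γ k ε (4 * (l * m)) u := fun u h0 hu => by
    have h1 := hfrac u h0
    have h2 : 0 ≤ 4 * (l * m) * u ^ 2 / (u + ε) ^ 2 := by positivity
    have h3 : l * ((u + ε) / (γ - 1)) ≤ l * (2 * ε / (γ - 1)) := by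
      gcongr; linarith
    unfold rate
    linarith
  refine ⟨ε, 4 * (l * m), hε, hB, fun u hu => solOp_barrier_le hε ?_ ?_ hu⟩
  · intro u hu
    rcases le_total ε u with h | h
    · exact (by positivity : 0 ≤ l * m).trans (hlarge u h)
    · exact (by positivity : 0 ≤ l * ((u + ε) / (γ - 1))).trans (hsmall u hu h)
  · intro u hu
    have hb := barrier_pos (γ := γ) (B := 4 * (l * m)) hu hε
    rcases le_total ε u with h | h
    · calc _ ≤ ENNReal.ofReal l * ENNReal.ofReal (barrier γ ε (4 * (l * m)) u * m) := by
            gcongr; exact jumpTerm_barrier_le_mean hν hmean hγ hε hB hu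
        _ ≤ _ := by
            rw [← ENNReal.ofReal_mul hl.le]
            refine ENNReal.ofReal_le_ofReal ?_
            nlinarith [hlarge u h]
    · calc _ ≤ ENNReal.ofReal l *
              ENNReal.ofReal (barrier γ ε (4 * (l * m)) u * ((u + ε) / (γ - 1))) := by
            gcongr; exact jumpTerm_barrier_le_tail hγ hε hB hu
        _ ≤ _ := by
            rw [← ENNReal.ofReal_mul hl.le]
            refine ENNReal.ofReal_le_ofReal ?_
            nlinarith [hsmall u hu h]

/-- A measurable fixed point of the integral operator lying below a barrier. -/
lemma exists_fixedPoint {γ k l : ℝ} (hγ : 1 < γ) (hk : 0 < k) (hl : 0 < l) {ν : Measure ℝ}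
    [IsProbabilityMeasure ν] (hν : ∀ᵐ y ∂ν, 0 < y) (hmean : Integrable (fun y => y) ν) :
    ∃ (ε B : ℝ) (f : ℝ → ENNReal), 0 < ε ∧ 0 ≤ B ∧ Measurable f ∧ solOp γ k l ν f = f ∧
      ∀ u, 0 < u → f u ≤ ENNReal.ofReal (barrier γ ε B u) := by
  obtain ⟨ε, B, hε, hB, hS⟩ := exists_barrier hγ hk hl hν hmean
  have hfix := OrderHom.map_lfp (solOp γ k l ν)
  refine ⟨ε, B, OrderHom.lfp (solOp γ k l ν), hε, hB, ?_, hfix, ?_⟩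
  · rw [← hfix]
    refine Measurable.mul (by unfold weight; fun_prop) (Measurable.const_add ?_ 1)
    exact Antitone.measurable fun u v huv => lintegral_mono_set (Ioi_subset_Ioi huv)
  · set b : ℝ → ENNReal := fun u => if 0 < u then ENNReal.ofReal (barrier γ ε B u) else ⊤
    have hle : OrderHom.lfp (solOp γ k l ν) ≤ b := by
      refine OrderHom.lfp_le _ fun u => ?_
      by_cases hu : 0 < u
      · have heq : solOp γ k l ν b u =
            solOp γ k l ν (fun v => ENNReal.ofReal (barrier γ ε B v)) u := by
          rw [solOp_apply, solOp_apply]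
          congr 2
          refine setLIntegral_congr_fun measurableSet_Ioi fun s hs => ?_
          congr 1
          refine lintegral_congr fun y => setLIntegral_congr_fun measurableSet_Ioc fun v hv => ?_
          exact if_pos ((hu.trans hs).trans hv.1)
        rw [heq]
        simpa [b, hu] using hS u hu
      · simp [b, hu]
    intro u hu
    simpa [b, hu] using hle u

lemma barrier_le {γ ε B u : ℝ} (hγ : 1 < γ) (hε : 0 < ε) (hB : 0 ≤ B) (hu : 0 < u) :
    barrier γ ε B u ≤ u ^ (-γ) * Real.exp (B / u) := by
  unfold barrier
  apply mul_le_mul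
  · exact Real.rpow_le_rpow_of_nonpos hu (by linarith) (by linarith)
  · gcongr; linarith
  · positivity
  · positivity

lemma integrableOn_barrier {γ ε B : ℝ} (hγ : 1 < γ) (hε : 0 < ε) (hB : 0 ≤ B) :
    IntegrableOn (barrier γ ε B) (Ioi 0) := by
  have h := (integrableOn_add_rpow_Ioi_of_lt (a := -γ) (c := 0) (m := ε) (by linarith)
    (by linarith)).mul_const (Real.exp (B / ε))
  refine h.mono' ?_ ?_
  · exact ContinuousOn.aestronglyMeasurable (fun x hx =>
      (hasDerivAt_barrier hx hε).continuousAt.continuousWithinAt) measurableSet_Ioi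
  · filter_upwards [ae_restrict_mem measurableSet_Ioi] with x hx
    have hx' : 0 < x := hx
    rw [Real.norm_of_nonneg (barrier_pos hx' hε).le]
    unfold barrier
    gcongr
    linarith

lemma hasDerivAt_integral_Ioi {F : ℝ → ℝ} (hF : ContinuousOn F (Ioi 0))
    (hint : ∀ u, 0 < u → IntegrableOn F (Ioi u)) {u : ℝ} (hu : 0 < u) :
    HasDerivAt (fun x => ∫ s in Ioi x, F s) (-F u) u := by
  have hu2 : 0 < u / 2 := by positivity
  have hii : IntervalIntegrable F volume (u / 2) u := by
    rw [intervalIntegrable_iff_integrableOn_Ioc_of_le (by linarith)]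
    exact (hint _ hu2).mono_set Ioc_subset_Ioi_self
  have hd := intervalIntegral.integral_hasDerivAt_right hii
    (hF.stronglyMeasurableAtFilter isOpen_Ioi u hu) (hF.continuousAt (Ioi_mem_nhds hu))
  refine (hd.const_sub (∫ s in Ioi (u / 2), F s)).congr_of_eventuallyEq ?_
  filter_upwards [Ioi_mem_nhds (by linarith : u / 2 < u)] with x hx
  rw [← intervalIntegral.integral_Ioi_sub_Ioi (hint _ hu2) (le_of_lt hx)]
  ring

/-- The jump term for a real density `g`. -/
noncomputable def jumpIntegral (ν : Measure ℝ) (g : ℝ → ℝ) (u : ℝ) : ℝ :=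
  ∫ y, ((∫ v in (0 : ℝ)..(u + y), g v) - ∫ v in (0 : ℝ)..u, g v) ∂ν

lemma abs_primitive_sub_le {g : ℝ → ℝ} (hg : Integrable g) (u v : ℝ) :
    |(∫ x in (0 : ℝ)..v, g x) - ∫ x in (0 : ℝ)..u, g x| ≤ ∫ x, ‖g x‖ := by
  rw [intervalIntegral.integral_interval_sub_left hg.intervalIntegrable hg.intervalIntegrable]
  exact intervalIntegral.norm_integral_le_integral_norm_uIoc.trans
    (setIntegral_le_integral hg.norm (ae_of_all _ fun _ => norm_nonneg _))

lemma continuous_primitive {g : ℝ → ℝ} (hg : Integrable g) :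
    Continuous fun u => ∫ x in (0 : ℝ)..u, g x :=
  intervalIntegral.continuous_primitive (fun _ _ => hg.intervalIntegrable) 0

lemma integrable_primitive_sub {ν : Measure ℝ} [IsProbabilityMeasure ν] {g : ℝ → ℝ}
    (hg : Integrable g) (u : ℝ) :
    Integrable (fun y => (∫ v in (0 : ℝ)..(u + y), g v) - ∫ v in (0 : ℝ)..u, g v) ν := by
  refine (integrable_const (∫ x, ‖g x‖)).mono' ?_ (ae_of_all _ fun y => abs_primitive_sub_le hg _ _)
  have := continuous_primitive hg
  exact ((this.comp (continuous_const.add continuous_id)).sub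
    continuous_const).aestronglyMeasurable

lemma continuous_jumpIntegral {ν : Measure ℝ} [IsProbabilityMeasure ν] {g : ℝ → ℝ}
    (hg : Integrable g) : Continuous (jumpIntegral ν g) := by
  have := continuous_primitive hg
  exact continuous_of_dominated (fun u => (integrable_primitive_sub hg u).aestronglyMeasurable)
    (fun u => ae_of_all _ fun y => abs_primitive_sub_le hg _ _)
    (integrable_const (∫ x, ‖g x‖))
    (ae_of_all _ fun y => (this.comp (continuous_id.add continuous_const)).sub this)

lemma ae_primitive_sub_nonneg {ν : Measure ℝ} (hν : ∀ᵐ y ∂ν, 0 < y) {g : ℝ → ℝ}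
    (hg : Integrable g) (hg0 : 0 ≤ g) (u : ℝ) :
    ∀ᵐ y ∂ν, 0 ≤ (∫ v in (0 : ℝ)..(u + y), g v) - ∫ v in (0 : ℝ)..u, g v := by
  filter_upwards [hν] with y hy
  rw [intervalIntegral.integral_interval_sub_left hg.intervalIntegrable hg.intervalIntegrable]
  exact intervalIntegral.integral_nonneg (by linarith) fun x _ => hg0 x

lemma jumpTerm_ofReal {ν : Measure ℝ} [IsProbabilityMeasure ν] (hν : ∀ᵐ y ∂ν, 0 < y) {g : ℝ → ℝ}
    (hg : Integrable g) (hg0 : 0 ≤ g) (u : ℝ) :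
    jumpTerm ν (fun v => ENNReal.ofReal (g v)) u = ENNReal.ofReal (jumpIntegral ν g u) := by
  unfold jumpTerm jumpIntegral
  rw [ofReal_integral_eq_lintegral_ofReal (integrable_primitive_sub hg u)
    (ae_primitive_sub_nonneg hν hg hg0 u)]
  refine lintegral_congr_ae ?_
  filter_upwards [hν] with y hy
  rw [intervalIntegral.integral_interval_sub_left hg.intervalIntegrable hg.intervalIntegrable,
    intervalIntegral.integral_of_le (by linarith),
    ofReal_integral_eq_lintegral_ofReal hg.integrableOn (ae_of_all _ hg0)]

/-- The density of the solution, with its two-sided power bounds and its first-order equation. -/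
lemma exists_density {γ k l : ℝ} (hγ : 1 < γ) (hk : 0 < k) (hl : 0 < l) {ν : Measure ℝ}
    [IsProbabilityMeasure ν] (hν : ∀ᵐ y ∂ν, 0 < y) (hmean : Integrable (fun y => y) ν) :
    ∃ (g : ℝ → ℝ) (B : ℝ), 0 ≤ B ∧ Integrable g ∧ 0 ≤ g ∧
      (∀ u, 0 < u → u ^ (-γ) * Real.exp (-k / u) ≤ g u) ∧
      (∀ u, 0 < u → g u ≤ u ^ (-γ) * Real.exp (B / u)) ∧
      ∀ u, 0 < u → HasDerivAt g
        (-(γ / u - k / u ^ 2) * g u - l / u ^ 2 * jumpIntegral ν g u) u := by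
  obtain ⟨ε, B, f, hε, hB, hfm, hfix, hfle⟩ := exists_fixedPoint hγ hk hl hν hmean
  set g : ℝ → ℝ := (Ioi 0).indicator fun u => (f u).toReal with hgdef
  have hg0 : 0 ≤ g := indicator_nonneg fun u _ => ENNReal.toReal_nonneg
  have hfg : ∀ u, 0 < u → f u = ENNReal.ofReal (g u) := fun u hu => by
    rw [hgdef, indicator_of_mem (mem_Ioi.2 hu),
      ENNReal.ofReal_toReal (ne_top_of_le_ne_top ENNReal.ofReal_ne_top (hfle u hu))]
  have hgle : ∀ u, 0 < u → g u ≤ barrier γ ε B u := fun u hu => by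
    have := hfle u hu
    rwa [hfg u hu, ENNReal.ofReal_le_ofReal_iff (barrier_pos hu hε).le] at this
  have hg : Integrable g := by
    rw [hgdef, integrable_indicator_iff measurableSet_Ioi]
    refine (integrableOn_barrier hγ hε hB).mono' hfm.ennreal_toReal.aestronglyMeasurable ?_
    filter_upwards [ae_restrict_mem measurableSet_Ioi] with x hx
    have := hgle x hx
    rw [hgdef, indicator_of_mem hx] at this
    rwa [Real.norm_of_nonneg ENNReal.toReal_nonneg]
  set F : ℝ → ℝ := fun s => l / s ^ 2 * weight γ k s * jumpIntegral ν g s with hF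
  have hFc : ContinuousOn F (Ioi 0) := fun s hs => by
    have hs' : s ≠ 0 := ne_of_gt hs
    exact (((continuousAt_const.div (continuousAt_id.pow 2) (by simpa using hs')).mul
      (hasDerivAt_weight hs).continuousAt).mul
        (continuous_jumpIntegral hg).continuousAt).continuousWithinAt
  have hF0 : ∀ s, 0 < s → 0 ≤ F s := fun s hs => by
    have h1 := weight_pos (γ := γ) (k := k) hs
    have h2 : 0 ≤ jumpIntegral ν g s := integral_nonneg_of_ae (ae_primitive_sub_nonneg hν hg hg0 s)
    simp only [hF]
    positivity
  have heq : ∀ u, 0 < u → ENNReal.ofReal (g u) =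
      ENNReal.ofReal (weight γ k u)⁻¹ * (1 + ∫⁻ s in Ioi u, ENNReal.ofReal (F s)) := fun u hu => by
    rw [← hfg u hu, ← congrFun hfix u, solOp_apply]
    congr 2
    refine setLIntegral_congr_fun measurableSet_Ioi fun s hs => ?_
    have hs' : 0 < s := hu.trans hs
    have hw := weight_pos (γ := γ) (k := k) hs'
    rw [hF, ENNReal.ofReal_mul (p := l / s ^ 2 * weight γ k s) (by positivity),
      ← jumpTerm_ofReal hν hg hg0]
    congr 1
    refine lintegral_congr fun y => setLIntegral_congr_fun measurableSet_Ioc fun v hv => ?_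
    exact hfg v (hs'.trans hv.1)
  have hFnn : ∀ u, 0 < u → 0 ≤ᵐ[volume.restrict (Ioi u)] F := fun u hu => by
    filter_upwards [ae_restrict_mem measurableSet_Ioi] with s hs
    exact hF0 s (hu.trans hs)
  have hFint : ∀ u, 0 < u → IntegrableOn F (Ioi u) := fun u hu => by
    refine ⟨(hFc.mono (Ioi_subset_Ioi hu.le)).aestronglyMeasurable measurableSet_Ioi, ?_⟩
    rw [hasFiniteIntegral_iff_ofReal (hFnn u hu), lt_top_iff_ne_top]
    intro htop
    have h := heq u hu
    rw [htop, add_top, ENNReal.mul_top] at h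
    · exact ENNReal.ofReal_ne_top h
    · simpa using weight_pos hu
  have hgeq : ∀ u, 0 < u → g u = (weight γ k u)⁻¹ * (1 + ∫ s in Ioi u, F s) := fun u hu => by
    have h := heq u hu
    have hw := weight_pos (γ := γ) (k := k) hu
    have hI : 0 ≤ ∫ s in Ioi u, F s := integral_nonneg_of_ae (hFnn u hu)
    rw [← ofReal_integral_eq_lintegral_ofReal (hFint u hu) (hFnn u hu), ← ENNReal.ofReal_one,
      ← ENNReal.ofReal_add zero_le_one hI, ← ENNReal.ofReal_mul (by positivity)] at h
    exact (ENNReal.ofReal_eq_ofReal_iff (hg0 u) (by positivity)).1 h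
  refine ⟨g, B, hB, hg, hg0, fun u hu => ?_, fun u hu => (hgle u hu).trans (barrier_le hγ hε hB hu),
    fun u hu => ?_⟩
  · have hI : 0 ≤ ∫ s in Ioi u, F s := integral_nonneg_of_ae (hFnn u hu)
    have hw := weight_pos (γ := γ) (k := k) hu
    calc u ^ (-γ) * Real.exp (-k / u) = (weight γ k u)⁻¹ := by
          rw [weight, mul_inv, Real.rpow_neg hu.le, neg_div, Real.exp_neg]
      _ ≤ _ := by
          rw [hgeq u hu]
          exact le_mul_of_one_le_right (by positivity) (by linarith)
  · have hw := weight_pos (γ := γ) (k := k) hu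
    have hd := ((hasDerivAt_weight (γ := γ) (k := k) hu).inv hw.ne').mul
      ((hasDerivAt_integral_Ioi hFc hFint hu).const_add 1)
    refine (hd.congr_of_eventuallyEq ?_).congr_deriv ?_
    · filter_upwards [Ioi_mem_nhds hu] with x hx
      exact hgeq x hx
    · rw [hgeq u hu]
      simp only [hF, Pi.inv_apply]
      field_simp
      ring

lemma tendsto_rpow_mul_tail {γ k B : ℝ} {g : ℝ → ℝ} (hγ : 1 < γ) (hk : 0 ≤ k) (hB : 0 ≤ B)
    (hg : Integrable g) (hlow : ∀ u, 0 < u → u ^ (-γ) * Real.exp (-k / u) ≤ g u)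
    (hup : ∀ u, 0 < u → g u ≤ u ^ (-γ) * Real.exp (B / u)) :
    Tendsto (fun u => u ^ (γ - 1) * ∫ v in Ioi u, g v) atTop (𝓝 (1 / (γ - 1))) := by
  have hγ' : 0 < γ - 1 := by linarith
  have hexp : ∀ b : ℝ, Tendsto (fun u : ℝ => Real.exp (b / u) / (γ - 1)) atTop
      (𝓝 (1 / (γ - 1))) := fun b => by
    simpa using (((tendsto_id (α := ℝ)).const_div_atTop b).rexp).div_const (γ - 1)
  have hpow : ∀ u : ℝ, 0 < u → ∀ a : ℝ,
      u ^ (γ - 1) * ∫ v in Ioi u, v ^ (-γ) * a = a / (γ - 1) := fun u hu a => by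
    rw [integral_mul_const, integral_Ioi_rpow_of_lt (by linarith) hu,
      show -γ + 1 = -(γ - 1) by ring, Real.rpow_neg hu.le]
    have : 0 < u ^ (γ - 1) := by positivity
    field_simp
  have hpint : ∀ u : ℝ, 0 < u → ∀ a : ℝ, IntegrableOn (fun v : ℝ => v ^ (-γ) * a) (Ioi u) :=
    fun u hu a => (integrableOn_Ioi_rpow_of_lt (by linarith) hu).mul_const a
  refine tendsto_of_tendsto_of_tendsto_of_le_of_le' (hexp (-k)) (hexp B) ?_ ?_
  · filter_upwards [eventually_gt_atTop 0] with u hu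
    rw [← hpow u hu]
    refine mul_le_mul_of_nonneg_left (setIntegral_mono_on (hpint u hu _) hg.integrableOn
      measurableSet_Ioi fun v hv => ?_) (by positivity)
    have hv' : u < v := hv
    have hv0 : 0 < v := hu.trans hv'
    refine le_trans ?_ (hlow v hv0)
    gcongr ?_ * Real.exp ?_
    rw [neg_div, neg_div]
    gcongr
  · filter_upwards [eventually_gt_atTop 0] with u hu
    rw [← hpow u hu]
    refine mul_le_mul_of_nonneg_left (setIntegral_mono_on hg.integrableOn (hpint u hu _)
      measurableSet_Ioi fun v hv => ?_) (by positivity)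
    have hv' : u < v := hv
    have hv0 : 0 < v := hu.trans hv'
    refine (hup v hv0).trans ?_
    gcongr

end RuinIDE

theorem stmt16
    (κ σ c lam a r : ℝ)
    (hκ : κ ∈ Set.Ioc (0 : ℝ) 1) (hσ : 0 < σ) (hc : 0 < c) (hlam : 0 < lam)
    (hγ : 1 < 2 * ((a - r) * κ + r) / (κ ^ 2 * σ ^ 2))
    (ν : Measure ℝ) [IsProbabilityMeasure ν]
    (hν : ν (Set.Ioi (0 : ℝ))ᶜ = 0)
    (hmean : Integrable (fun y => y) ν) :
    ∃ Φ : ℝ → ℝ, ∃ C : ℝ, 0 < C ∧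
      ContinuousOn Φ (Set.Ici 0) ∧
      (∀ u ∈ Set.Ioi (0 : ℝ), DifferentiableAt ℝ Φ u) ∧
      (∀ u ∈ Set.Ioi (0 : ℝ), DifferentiableAt ℝ (deriv Φ) u) ∧
      ContinuousOn (deriv (deriv Φ)) (Set.Ioi 0) ∧
      Φ 0 = 0 ∧
      Tendsto Φ atTop (nhds 1) ∧
      (∀ u ∈ Set.Ioi (0 : ℝ),
        (1 / 2) * κ ^ 2 * σ ^ 2 * u ^ 2 * deriv (deriv Φ) u +
            ((a - r) * κ + r) * u * deriv Φ u
          = c * deriv Φ u - lam * ∫ y in Set.Ioi (0 : ℝ), (Φ (u + y) - Φ u) ∂ν) ∧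
      Tendsto (fun u => u ^ (2 * ((a - r) * κ + r) / (κ ^ 2 * σ ^ 2) - 1) * (1 - Φ u))
        atTop (nhds C) := by
  obtain ⟨hκ0, -⟩ := hκ
  set b := (a - r) * κ + r
  set γ := 2 * b / (κ ^ 2 * σ ^ 2) with hγdef
  set A := κ ^ 2 * σ ^ 2 / 2 with hA
  have hA0 : 0 < A := by positivity
  have hb : b = γ * A := by rw [hγdef, hA]; field_simp
  have hν' : ∀ᵐ y ∂ν, 0 < y := by
    rw [ae_iff]
    exact hν
  have hk : 0 < c / A := by positivity
  have hl : 0 < lam / A := by positivity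
  obtain ⟨g, B, hB, hg, hg0, hlow, hup, hd⟩ := RuinIDE.exists_density hγ hk hl hν' hmean
  set G : ℝ → ℝ := fun u => ∫ v in (0 : ℝ)..u, g v with hG
  set I := ∫ v in Ioi (0 : ℝ), g v with hI
  have hGtail : ∀ u, 0 < u → G u = I - ∫ v in Ioi u, g v := fun u hu => by
    rw [hI, hG]
    dsimp only
    rw [← intervalIntegral.integral_Ioi_sub_Ioi hg.integrableOn hu.le]
  have hI0 : 0 < I := by
    rw [hI, setIntegral_pos_iff_support_of_nonneg_ae (ae_of_all _ hg0) hg.integrableOn]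
    have : Function.support g ∩ Ioi 0 = Ioi 0 := inter_eq_right.2 fun u hu => by
      have hu' : 0 < u := hu
      exact ((by positivity : 0 < u ^ (-γ) * Real.exp (-(c / A) / u)).trans_le (hlow u hu)).ne'
    rw [this]
    simp
  have hGd : ∀ u, 0 < u → HasDerivAt (fun x => G x / I) (g u / I) u := fun u hu =>
    (intervalIntegral.integral_hasDerivAt_right hg.intervalIntegrable
      hg.aestronglyMeasurable.stronglyMeasurableAtFilter (hd u hu).continuousAt).div_const I
  have hderiv : ∀ u, 0 < u → deriv (fun x => G x / I) =ᶠ[𝓝 u] fun x => g x / I := fun u hu => by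
    filter_upwards [Ioi_mem_nhds hu] with x hx
    exact (hGd x hx).deriv
  have hGdd : ∀ u, 0 < u → HasDerivAt (deriv fun x => G x / I)
      ((-(γ / u - c / A / u ^ 2) * g u - lam / A / u ^ 2 * RuinIDE.jumpIntegral ν g u) / I) u :=
    fun u hu => ((hd u hu).div_const I).congr_of_eventuallyEq (hderiv u hu)
  have htail := RuinIDE.tendsto_rpow_mul_tail hγ hk.le hB hg hlow hup
  have hγ' : 0 < γ - 1 := by linarith
  have hone : ∀ u, 0 < u → 1 - G u / I = (∫ v in Ioi u, g v) / I := fun u hu => by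
    rw [hGtail u hu]
    field_simp
    ring
  refine ⟨fun u => G u / I, 1 / (γ - 1) / I, by positivity, ?_, ?_, ?_, ?_, ?_, ?_, ?_, ?_⟩
  · exact ((RuinIDE.continuous_primitive hg).div_const I).continuousOn
  · exact fun u hu => (hGd u hu).differentiableAt
  · exact fun u hu => (hGdd u hu).differentiableAt
  · have hc' : ContinuousOn (fun u => (-(γ / u - c / A / u ^ 2) * g u -
        lam / A / u ^ 2 * RuinIDE.jumpIntegral ν g u) / I) (Ioi 0) := by
      have h1 : ContinuousOn g (Ioi 0) := fun u hu => (hd u hu).continuousAt.continuousWithinAt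
      have h2 : ContinuousOn (RuinIDE.jumpIntegral ν g) (Ioi 0) :=
        (RuinIDE.continuous_jumpIntegral hg).continuousOn
      have h3 : ∀ u ∈ Ioi (0 : ℝ), u ≠ 0 := fun u hu => ne_of_gt hu
      have h4 : ∀ u ∈ Ioi (0 : ℝ), u ^ 2 ≠ 0 := fun u hu => pow_ne_zero 2 (h3 u hu)
      fun_prop (disch := assumption)
    exact hc'.congr fun u hu => (hGdd u hu).deriv
  · simp [hG]
  · have h := intervalIntegral_tendsto_integral_Ioi 0 hg.integrableOn tendsto_id
    rw [← div_self hI0.ne']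
    exact h.div_const I
  · intro u hu
    have hu' : 0 < u := hu
    have hint : ∫ y in Ioi (0 : ℝ), (G (u + y) / I - G u / I) ∂ν =
        RuinIDE.jumpIntegral ν g u / I := by
      rw [Measure.restrict_eq_self_of_ae_mem (s := Ioi 0) hν', RuinIDE.jumpIntegral, ← integral_div]
      refine integral_congr_ae (ae_of_all _ fun y => ?_)
      simp only [hG]
      ring
    rw [(hGdd u hu).deriv, (hGd u hu).deriv, hint, hb,
      show 1 / 2 * κ ^ 2 * σ ^ 2 = A by rw [hA]; ring]
    field_simp
    ring
  · refine (htail.div_const I).congr' ?_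
    filter_upwards [eventually_gt_atTop 0] with u hu
    rw [hone u hu, mul_div_assoc]
end

section
/- Let γ > 0 and u₀ > μ m. Then the map S : g ↦ g₀ + T g, where g₀(u) := u^{−γ} e^{−α/u} and T g(u) := μ u^{−γ} e^{−α/u} ∫_u^∞ t^{γ−2} e^{α/t} (∫₀^∞ g(t+z) F̄(z) dz) dt, is a contraction of the Banach space X_{γ,u₀} := {g continuous on [u₀,∞) : ‖g‖_{γ,u₀} := sup_{x ≥ u₀} x^γ |g(x)| < ∞} (with the norm ‖·‖_{γ,u₀}) with contraction constant θ := μ m / u₀ < 1; consequently there exists a unique g* ∈ X_{γ,u₀} with g* = g₀ + T g*. -/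
open MeasureTheory Set Filter Topology

/-- The weighted sup-norm `‖g‖_{γ,u₀} = sup_{x ≥ u₀} x^γ |g(x)|`. -/
noncomputable def pnorm (p u₀ : ℝ) (g : ℝ → ℝ) : ℝ :=
  ⨆ x : {x : ℝ // u₀ ≤ x}, (x : ℝ) ^ p * |g x|

/-- Membership in the Banach space `X_{γ,u₀}`: continuous on `[u₀,∞)` with finite
weighted sup-norm. -/
def MemX (γ u₀ : ℝ) (g : ℝ → ℝ) : Prop :=
  ContinuousOn g (Set.Ici u₀) ∧
  BddAbove (Set.range fun x : {x : ℝ // u₀ ≤ x} => (x : ℝ) ^ γ * |g x|)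

/-- The operator `T g (u) = μ u^{-γ} e^{-α/u} ∫_u^∞ t^{γ-2} e^{α/t} (∫₀^∞ g(t+z) F̄(z) dz) dt`. -/
noncomputable def opT (μ α γ : ℝ) (Fbar g : ℝ → ℝ) (u : ℝ) : ℝ :=
  μ * u ^ (-γ) * Real.exp (-(α / u)) *
    ∫ t in Set.Ioi u, t ^ (γ - 2) * Real.exp (α / t) *
      ∫ z in Set.Ioi (0 : ℝ), g (t + z) * Fbar z

/-- The map `S g = g₀ + T g`. -/
noncomputable def opS (μ α γ : ℝ) (Fbar g : ℝ → ℝ) (u : ℝ) : ℝ :=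
  u ^ (-γ) * Real.exp (-(α / u)) + opT μ α γ Fbar g u

/-- The inner integral `∫₀^∞ g(t+z) F̄(z) dz` of the operator `opT`. -/
noncomputable def innerInt (Fbar g : ℝ → ℝ) (t : ℝ) : ℝ :=
  ∫ z in Set.Ioi (0 : ℝ), g (t + z) * Fbar z

/-- The outer integrand of the operator `opT`. -/
noncomputable def outerFun (α γ : ℝ) (Fbar g : ℝ → ℝ) (t : ℝ) : ℝ :=
  t ^ (γ - 2) * Real.exp (α / t) * innerInt Fbar g t

lemma opT_eq (μ α γ : ℝ) (Fbar g : ℝ → ℝ) (u : ℝ) :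
    opT μ α γ Fbar g u =
      μ * u ^ (-γ) * Real.exp (-(α / u)) * ∫ t in Set.Ioi u, outerFun α γ Fbar g t := rfl

lemma MemX.exists_bound {γ u₀ : ℝ} {g : ℝ → ℝ} (hg : MemX γ u₀ g) :
    ∃ C, ∀ x, u₀ ≤ x → x ^ γ * |g x| ≤ C := by
  obtain ⟨C, hC⟩ := hg.2
  exact ⟨C, fun x hx => hC ⟨⟨x, hx⟩, rfl⟩⟩

lemma MemX.of_bound {γ u₀ C : ℝ} {g : ℝ → ℝ} (hg : ContinuousOn g (Set.Ici u₀))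
    (hC : ∀ x, u₀ ≤ x → x ^ γ * |g x| ≤ C) : MemX γ u₀ g := by
  refine ⟨hg, C, ?_⟩
  rintro _ ⟨x, rfl⟩
  exact hC x x.2

lemma MemX.sub {γ u₀ : ℝ} {g h : ℝ → ℝ} (hu₀ : 0 < u₀) (hg : MemX γ u₀ g) (hh : MemX γ u₀ h) :
    MemX γ u₀ (fun x => g x - h x) := by
  obtain ⟨C, hC⟩ := hg.exists_bound
  obtain ⟨D, hD⟩ := hh.exists_bound
  refine MemX.of_bound (C := C + D) (hg.1.sub hh.1) fun x hx => ?_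
  have hx0 : 0 ≤ x ^ γ := Real.rpow_nonneg (hu₀.le.trans hx) _
  calc x ^ γ * |g x - h x| ≤ x ^ γ * (|g x| + |h x|) := by gcongr; exact abs_sub _ _
    _ ≤ C + D := by rw [mul_add]; exact add_le_add (hC x hx) (hD x hx)

lemma MemX.le_pnorm {γ u₀ : ℝ} {g : ℝ → ℝ} (hg : MemX γ u₀ g) {x : ℝ} (hx : u₀ ≤ x) :
    x ^ γ * |g x| ≤ pnorm γ u₀ g :=
  le_ciSup hg.2 (⟨x, hx⟩ : {x : ℝ // u₀ ≤ x})

lemma pnorm_le {γ u₀ C : ℝ} {g : ℝ → ℝ} (hC : ∀ x, u₀ ≤ x → x ^ γ * |g x| ≤ C) :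
    pnorm γ u₀ g ≤ C :=
  have : Nonempty {x : ℝ // u₀ ≤ x} := ⟨⟨u₀, le_rfl⟩⟩
  ciSup_le fun x => hC x x.2

lemma abs_le_of_weighted {γ u₀ C : ℝ} {g : ℝ → ℝ} (hγ : 0 < γ) (hu₀ : 0 < u₀)
    (hC : ∀ x, u₀ ≤ x → x ^ γ * |g x| ≤ C) {t x : ℝ} (ht : u₀ ≤ t) (hx : t ≤ x) :
    |g x| ≤ C * t ^ (-γ) := by
  have ht0 : 0 < t := hu₀.trans_le ht
  have htp : 0 < t ^ γ := Real.rpow_pos_of_pos ht0 _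
  rw [Real.rpow_neg ht0.le, ← div_eq_mul_inv, le_div_iff₀ htp]
  calc |g x| * t ^ γ ≤ |g x| * x ^ γ := by gcongr
    _ ≤ C := by rw [mul_comm]; exact hC x (ht.trans hx)

lemma continuousOn_shift {u₀ t : ℝ} {g : ℝ → ℝ} (hg : ContinuousOn g (Set.Ici u₀))
    (ht : u₀ ≤ t) : ContinuousOn (fun z => g (t + z)) (Set.Ioi 0) :=
  hg.comp (by fun_prop) fun z hz => by
    have : 0 < z := hz
    simp only [Set.mem_Ici]; linarith

lemma integrableOn_shift_mul {γ u₀ t : ℝ} {Fbar g : ℝ → ℝ} (hγ : 0 < γ) (hu₀ : 0 < u₀)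
    (hF : IntegrableOn Fbar (Set.Ioi 0)) (hg : MemX γ u₀ g) (ht : u₀ ≤ t) :
    IntegrableOn (fun z => g (t + z) * Fbar z) (Set.Ioi 0) := by
  obtain ⟨C, hC⟩ := hg.exists_bound
  refine Integrable.bdd_mul (c := C * t ^ (-γ)) hF
    ((continuousOn_shift hg.1 ht).aestronglyMeasurable measurableSet_Ioi) ?_
  filter_upwards [ae_restrict_mem measurableSet_Ioi] with z hz
  have : 0 < z := hz
  exact abs_le_of_weighted hγ hu₀ hC ht (by linarith)

lemma continuousOn_innerInt {γ u₀ : ℝ} {Fbar g : ℝ → ℝ} (hγ : 0 < γ) (hu₀ : 0 < u₀)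
    (hF : IntegrableOn Fbar (Set.Ioi 0)) (hg : MemX γ u₀ g) :
    ContinuousOn (innerInt Fbar g) (Set.Ici u₀) := by
  obtain ⟨C, hC⟩ := hg.exists_bound
  refine continuousOn_of_dominated (bound := fun z => C * u₀ ^ (-γ) * |Fbar z|)
    (fun t ht => (integrableOn_shift_mul hγ hu₀ hF hg ht).aestronglyMeasurable)
    (fun t ht => ?_) (hF.abs.const_mul _) ?_
  · filter_upwards [ae_restrict_mem measurableSet_Ioi] with z hz
    have hz : 0 < z := hz
    have ht : u₀ ≤ t := ht
    rw [Real.norm_eq_abs, abs_mul]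
    gcongr
    exact abs_le_of_weighted hγ hu₀ hC le_rfl (by linarith)
  · filter_upwards [ae_restrict_mem measurableSet_Ioi] with z hz
    have hz : 0 < z := hz
    refine ContinuousOn.mul (hg.1.comp (by fun_prop) fun t ht => ?_) continuousOn_const
    have ht : u₀ ≤ t := ht
    simp only [Set.mem_Ici]; linarith

lemma abs_innerInt_le {γ u₀ C t : ℝ} {Fbar g : ℝ → ℝ} (hγ : 0 < γ) (hu₀ : 0 < u₀)
    (hF : IntegrableOn Fbar (Set.Ioi 0)) (hF0 : ∀ y ∈ Set.Ici (0 : ℝ), 0 ≤ Fbar y)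
    (hC : ∀ x, u₀ ≤ x → x ^ γ * |g x| ≤ C) (ht : u₀ ≤ t) :
    |innerInt Fbar g t| ≤ C * t ^ (-γ) * ∫ z in Set.Ioi (0 : ℝ), Fbar z := by
  rw [← integral_const_mul, ← Real.norm_eq_abs]
  refine norm_integral_le_of_norm_le (hF.const_mul _) ?_
  filter_upwards [ae_restrict_mem measurableSet_Ioi] with z hz
  have hz : 0 < z := hz
  rw [Real.norm_eq_abs, abs_mul, abs_of_nonneg (hF0 z hz.le)]
  exact mul_le_mul_of_nonneg_right (abs_le_of_weighted hγ hu₀ hC ht (by linarith)) (hF0 z hz.le)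

lemma continuousOn_outerFun {α γ u₀ : ℝ} {Fbar g : ℝ → ℝ} (hγ : 0 < γ) (hu₀ : 0 < u₀)
    (hF : IntegrableOn Fbar (Set.Ioi 0)) (hg : MemX γ u₀ g) :
    ContinuousOn (outerFun α γ Fbar g) (Set.Ici u₀) := by
  have hne : ∀ t ∈ Set.Ici u₀, t ≠ 0 := fun t ht => (hu₀.trans_le ht).ne'
  refine ContinuousOn.mul (ContinuousOn.mul ?_ ?_) (continuousOn_innerInt hγ hu₀ hF hg)
  · exact continuousOn_id.rpow_const fun t ht => Or.inl (hne t ht)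
  · exact (continuousOn_const.div continuousOn_id hne).rexp

lemma abs_outerFun_le {α γ u₀ C u t : ℝ} {Fbar g : ℝ → ℝ} (hα : 0 < α) (hγ : 0 < γ)
    (hu₀ : 0 < u₀) (hF : IntegrableOn Fbar (Set.Ioi 0))
    (hF0 : ∀ y ∈ Set.Ici (0 : ℝ), 0 ≤ Fbar y)
    (hC : ∀ x, u₀ ≤ x → x ^ γ * |g x| ≤ C) (hu : u₀ ≤ u) (ht : u ≤ t) :
    |outerFun α γ Fbar g t| ≤
      C * (∫ z in Set.Ioi (0 : ℝ), Fbar z) * Real.exp (α / u) * t ^ (-2 : ℝ) := by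
  have hu0 : 0 < u := hu₀.trans_le hu
  have ht0 : 0 < t := hu0.trans_le ht
  have hC0 : 0 ≤ C := (by positivity : 0 ≤ u ^ γ * |g u|).trans (hC u hu)
  have hm0 : 0 ≤ ∫ z in Set.Ioi (0 : ℝ), Fbar z :=
    setIntegral_nonneg measurableSet_Ioi fun z hz => hF0 z (Set.Ioi_subset_Ici_self hz)
  have hpow : t ^ (γ - 2) * t ^ (-γ) = t ^ (-2 : ℝ) := by
    rw [← Real.rpow_add ht0]; congr 1; ring
  rw [outerFun, abs_mul, abs_of_nonneg (by positivity : 0 ≤ t ^ (γ - 2) * Real.exp (α / t))]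
  calc t ^ (γ - 2) * Real.exp (α / t) * |innerInt Fbar g t|
      ≤ t ^ (γ - 2) * Real.exp (α / u) * (C * t ^ (-γ) * ∫ z in Set.Ioi (0 : ℝ), Fbar z) := by
        gcongr
        exact abs_innerInt_le hγ hu₀ hF hF0 hC (hu.trans ht)
    _ = C * (∫ z in Set.Ioi (0 : ℝ), Fbar z) * Real.exp (α / u) * t ^ (-2 : ℝ) := by
        rw [← hpow]; ring

lemma integrableOn_outerFun {α γ u₀ u : ℝ} {Fbar g : ℝ → ℝ} (hα : 0 < α) (hγ : 0 < γ)
    (hu₀ : 0 < u₀) (hF : IntegrableOn Fbar (Set.Ioi 0))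
    (hF0 : ∀ y ∈ Set.Ici (0 : ℝ), 0 ≤ Fbar y) (hg : MemX γ u₀ g) (hu : u₀ ≤ u) :
    IntegrableOn (outerFun α γ Fbar g) (Set.Ioi u) := by
  obtain ⟨C, hC⟩ := hg.exists_bound
  refine Integrable.mono' ((integrableOn_Ioi_rpow_of_lt (a := -2) (by norm_num)
    (hu₀.trans_le hu)).const_mul (C * (∫ z in Set.Ioi (0 : ℝ), Fbar z) * Real.exp (α / u)))
    (((continuousOn_outerFun hγ hu₀ hF hg).mono
      fun t ht => hu.trans (le_of_lt ht)).aestronglyMeasurable measurableSet_Ioi) ?_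
  filter_upwards [ae_restrict_mem measurableSet_Ioi] with t ht
  exact abs_outerFun_le hα hγ hu₀ hF hF0 hC hu (le_of_lt ht)

lemma abs_opT_le {μ α γ u₀ C u : ℝ} {Fbar g : ℝ → ℝ} (hμ : 0 < μ) (hα : 0 < α) (hγ : 0 < γ)
    (hu₀ : 0 < u₀) (hF : IntegrableOn Fbar (Set.Ioi 0))
    (hF0 : ∀ y ∈ Set.Ici (0 : ℝ), 0 ≤ Fbar y)
    (hC : ∀ x, u₀ ≤ x → x ^ γ * |g x| ≤ C) (hu : u₀ ≤ u) :
    u ^ γ * |opT μ α γ Fbar g u| ≤ μ * (∫ z in Set.Ioi (0 : ℝ), Fbar z) / u₀ * C := by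
  have hu0 : 0 < u := hu₀.trans_le hu
  have hC0 : 0 ≤ C := (by positivity : 0 ≤ u ^ γ * |g u|).trans (hC u hu)
  have hm0 : 0 ≤ ∫ z in Set.Ioi (0 : ℝ), Fbar z :=
    setIntegral_nonneg measurableSet_Ioi fun z hz => hF0 z (Set.Ioi_subset_Ici_self hz)
  set M := ∫ z in Set.Ioi (0 : ℝ), Fbar z
  have hI : |∫ t in Set.Ioi u, outerFun α γ Fbar g t| ≤ C * M * Real.exp (α / u) * u⁻¹ := by
    have h2 : ∫ t in Set.Ioi u, t ^ (-2 : ℝ) = u⁻¹ := by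
      rw [integral_Ioi_rpow_of_lt (by norm_num) hu0]
      norm_num [Real.rpow_neg_one]
    rw [← h2, ← integral_const_mul, ← Real.norm_eq_abs]
    refine norm_integral_le_of_norm_le
      ((integrableOn_Ioi_rpow_of_lt (a := -2) (by norm_num) hu0).const_mul _) ?_
    filter_upwards [ae_restrict_mem measurableSet_Ioi] with t ht
    exact abs_outerFun_le hα hγ hu₀ hF hF0 hC hu (le_of_lt ht)
  have hpow : u ^ γ * u ^ (-γ) = 1 := by rw [← Real.rpow_add hu0]; simp
  have hexp : Real.exp (-(α / u)) * Real.exp (α / u) = 1 := by rw [← Real.exp_add]; simp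
  rw [opT_eq, abs_mul,
    abs_of_nonneg (by positivity : 0 ≤ μ * u ^ (-γ) * Real.exp (-(α / u)))]
  calc u ^ γ * (μ * u ^ (-γ) * Real.exp (-(α / u)) * |∫ t in Set.Ioi u, outerFun α γ Fbar g t|)
      ≤ u ^ γ * (μ * u ^ (-γ) * Real.exp (-(α / u)) * (C * M * Real.exp (α / u) * u⁻¹)) := by
        gcongr
    _ = (u ^ γ * u ^ (-γ)) * (Real.exp (-(α / u)) * Real.exp (α / u)) * (μ * M * C * u⁻¹) := by
        ring
    _ = μ * M * C * u⁻¹ := by rw [hpow, hexp]; ring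
    _ ≤ μ * M * C * u₀⁻¹ := by gcongr
    _ = μ * M / u₀ * C := by ring

lemma continuousOn_rpow_neg_mul_exp {α γ u₀ : ℝ} (hu₀ : 0 < u₀) :
    ContinuousOn (fun u : ℝ => u ^ (-γ) * Real.exp (-(α / u))) (Set.Ici u₀) := by
  have hne : ∀ t ∈ Set.Ici u₀, t ≠ 0 := fun t ht => (hu₀.trans_le ht).ne'
  refine ContinuousOn.mul ?_ ?_
  · exact continuousOn_id.rpow_const fun t ht => Or.inl (hne t ht)
  · exact (continuousOn_const.div continuousOn_id hne).neg.rexp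

lemma continuousOn_integral_Ioi {f : ℝ → ℝ} {a : ℝ} (hf : IntegrableOn f (Set.Ioi a)) :
    ContinuousOn (fun u => ∫ t in Set.Ioi u, f t) (Set.Ici a) := by
  have hcont : ContinuousOn (fun u => ∫ t in Set.Ioc a u, f t) (Set.Ici a) := by
    intro u hu
    have hu : a ≤ u := hu
    have h := intervalIntegral.continuousOn_primitive (μ := volume) (a := a) (b := u + 1)
      ((integrableOn_Icc_iff_integrableOn_Ioc (by simp)).2 (hf.mono_set Set.Ioc_subset_Ioi_self))
    refine (h u ⟨hu, by linarith⟩).mono_of_mem_nhdsWithin ?_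
    filter_upwards [self_mem_nhdsWithin,
      mem_nhdsWithin_of_mem_nhds (Iio_mem_nhds (lt_add_one u))] with x hx hx'
    exact ⟨hx, le_of_lt hx'⟩
  refine ((continuousOn_const (c := ∫ t in Set.Ioi a, f t)).sub hcont).congr fun u hu => ?_
  have hu : a ≤ u := hu
  have h := setIntegral_union (μ := volume) (f := f) (Set.Ioc_disjoint_Ioi (le_refl u))
    measurableSet_Ioi (hf.mono_set (fun x hx => hx.1 : Set.Ioc a u ⊆ Set.Ioi a))
    (hf.mono_set (Set.Ioi_subset_Ioi hu))
  rw [Set.Ioc_union_Ioi_eq_Ioi hu] at h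
  rw [Pi.sub_apply, h]
  ring

lemma memX_opS {μ α γ u₀ : ℝ} {Fbar g : ℝ → ℝ} (hμ : 0 < μ) (hα : 0 < α) (hγ : 0 < γ)
    (hu₀ : 0 < u₀) (hF : IntegrableOn Fbar (Set.Ioi 0))
    (hF0 : ∀ y ∈ Set.Ici (0 : ℝ), 0 ≤ Fbar y) (hg : MemX γ u₀ g) :
    MemX γ u₀ (opS μ α γ Fbar g) := by
  obtain ⟨C, hC⟩ := hg.exists_bound
  have hg₀ := continuousOn_rpow_neg_mul_exp (α := α) (γ := γ) hu₀
  refine MemX.of_bound (C := 1 + μ * (∫ z in Set.Ioi (0 : ℝ), Fbar z) / u₀ * C)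
    (hg₀.add ?_) fun u hu => ?_
  · have hI := continuousOn_integral_Ioi (integrableOn_outerFun hα hγ hu₀ hF hF0 hg le_rfl)
    refine ((continuousOn_const (c := μ)).mul (hg₀.mul hI)).congr fun u _ => ?_
    rw [opT_eq, Pi.mul_apply, Pi.mul_apply]
    ring
  · have hu0 : 0 < u := hu₀.trans_le hu
    have hpow : u ^ γ * u ^ (-γ) = 1 := by rw [← Real.rpow_add hu0]; simp
    have hexp : Real.exp (-(α / u)) ≤ 1 :=
      Real.exp_le_one_iff.2 (neg_nonpos.2 (by positivity))
    calc u ^ γ * |opS μ α γ Fbar g u|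
        ≤ u ^ γ * (|u ^ (-γ) * Real.exp (-(α / u))| + |opT μ α γ Fbar g u|) := by
          gcongr; exact abs_add_le _ _
      _ = u ^ γ * u ^ (-γ) * Real.exp (-(α / u)) + u ^ γ * |opT μ α γ Fbar g u| := by
          rw [abs_of_nonneg (by positivity : 0 ≤ u ^ (-γ) * Real.exp (-(α / u)))]; ring
      _ ≤ 1 + μ * (∫ z in Set.Ioi (0 : ℝ), Fbar z) / u₀ * C := by
          rw [hpow, one_mul]
          exact add_le_add hexp (abs_opT_le hμ hα hγ hu₀ hF hF0 hC hu)

lemma opS_sub_opS {μ α γ u₀ u : ℝ} {Fbar g h : ℝ → ℝ} (hα : 0 < α) (hγ : 0 < γ)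
    (hu₀ : 0 < u₀) (hF : IntegrableOn Fbar (Set.Ioi 0))
    (hF0 : ∀ y ∈ Set.Ici (0 : ℝ), 0 ≤ Fbar y) (hg : MemX γ u₀ g) (hh : MemX γ u₀ h)
    (hu : u₀ ≤ u) :
    opS μ α γ Fbar g u - opS μ α γ Fbar h u = opT μ α γ Fbar (fun x => g x - h x) u := by
  have houter : ∀ t ∈ Set.Ioi u, outerFun α γ Fbar (fun x => g x - h x) t =
      outerFun α γ Fbar g t - outerFun α γ Fbar h t := by
    intro t ht
    have ht : u₀ ≤ t := hu.trans (le_of_lt ht)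
    have hinner : innerInt Fbar (fun x => g x - h x) t =
        innerInt Fbar g t - innerInt Fbar h t := by
      simp only [innerInt, sub_mul]
      exact integral_sub (integrableOn_shift_mul hγ hu₀ hF hg ht)
        (integrableOn_shift_mul hγ hu₀ hF hh ht)
    rw [outerFun, hinner, outerFun, outerFun]
    ring
  rw [opS, opS, opT_eq, opT_eq, opT_eq, setIntegral_congr_fun measurableSet_Ioi houter,
    integral_sub (integrableOn_outerFun hα hγ hu₀ hF hF0 hg hu)
      (integrableOn_outerFun hα hγ hu₀ hF hF0 hh hu)]
  ring

lemma abs_opS_sub_opS_le {μ α γ u₀ C u : ℝ} {Fbar g h : ℝ → ℝ} (hμ : 0 < μ) (hα : 0 < α)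
    (hγ : 0 < γ) (hu₀ : 0 < u₀) (hF : IntegrableOn Fbar (Set.Ioi 0))
    (hF0 : ∀ y ∈ Set.Ici (0 : ℝ), 0 ≤ Fbar y) (hg : MemX γ u₀ g) (hh : MemX γ u₀ h)
    (hC : ∀ x, u₀ ≤ x → x ^ γ * |g x - h x| ≤ C) (hu : u₀ ≤ u) :
    u ^ γ * |opS μ α γ Fbar g u - opS μ α γ Fbar h u| ≤
      μ * (∫ z in Set.Ioi (0 : ℝ), Fbar z) / u₀ * C := by
  rw [opS_sub_opS hα hγ hu₀ hF hF0 hg hh hu]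
  exact abs_opT_le hμ hα hγ hu₀ hF hF0 hC hu

open scoped BoundedContinuousFunction in
/-- The isometric identification of bounded continuous functions on `[u₀,∞)` with `X_{γ,u₀}`. -/
noncomputable def ofBCF (γ u₀ : ℝ) (φ : {x : ℝ // u₀ ≤ x} →ᵇ ℝ) (x : ℝ) : ℝ :=
  x ^ (-γ) * φ ⟨max u₀ x, le_max_left _ _⟩

open scoped BoundedContinuousFunction in
lemma rpow_mul_ofBCF {γ u₀ : ℝ} (hu₀ : 0 < u₀) (φ : {x : ℝ // u₀ ≤ x} →ᵇ ℝ)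
    (x : {x : ℝ // u₀ ≤ x}) : (x : ℝ) ^ γ * ofBCF γ u₀ φ x = φ x := by
  have hx : (0 : ℝ) < x := hu₀.trans_le x.2
  have hmax : (⟨max u₀ x, le_max_left _ _⟩ : {x : ℝ // u₀ ≤ x}) = x :=
    Subtype.ext (max_eq_right x.2)
  rw [ofBCF, hmax, ← mul_assoc, ← Real.rpow_add hx]
  simp

open scoped BoundedContinuousFunction in
lemma memX_ofBCF {γ u₀ : ℝ} (hu₀ : 0 < u₀) (φ : {x : ℝ // u₀ ≤ x} →ᵇ ℝ) :
    MemX γ u₀ (ofBCF γ u₀ φ) := by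
  refine MemX.of_bound (C := ‖φ‖) ?_ fun x hx => ?_
  · refine ContinuousOn.mul
      (continuousOn_id.rpow_const fun t ht => Or.inl (hu₀.trans_le ht).ne') ?_
    exact (φ.continuous.comp (by fun_prop)).continuousOn
  · have hx0 : 0 ≤ x ^ γ := Real.rpow_nonneg (hu₀.le.trans hx) _
    rw [← abs_of_nonneg hx0, ← abs_mul, rpow_mul_ofBCF hu₀ φ ⟨x, hx⟩]
    exact φ.norm_coe_le_norm _

open scoped BoundedContinuousFunction in
lemma MemX.exists_bcf {γ u₀ : ℝ} {g : ℝ → ℝ} (hu₀ : 0 < u₀) (hg : MemX γ u₀ g) :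
    ∃ φ : {x : ℝ // u₀ ≤ x} →ᵇ ℝ, ∀ x, φ x = (x : ℝ) ^ γ * g x := by
  obtain ⟨C, hC⟩ := hg.exists_bound
  have hcont : Continuous fun x : {x : ℝ // u₀ ≤ x} => (x : ℝ) ^ γ * g x := by
    refine (continuous_subtype_val.rpow_const fun x => Or.inl (hu₀.trans_le x.2).ne').mul ?_
    exact continuousOn_iff_continuous_domRestrict.1 hg.1
  refine ⟨BoundedContinuousFunction.ofNormedAddCommGroup _ hcont C fun x => ?_, fun x => rfl⟩
  rw [Real.norm_eq_abs, abs_mul, abs_of_nonneg (Real.rpow_nonneg (hu₀.le.trans x.2) _)]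
  exact hC x x.2

/-- Banach's fixed point theorem in `X_{γ,u₀}`. -/
lemma exists_fixedPoint_of_weighted_contraction {γ u₀ θ : ℝ} {S : (ℝ → ℝ) → ℝ → ℝ}
    (hu₀ : 0 < u₀) (hθ0 : 0 ≤ θ) (hθ : θ < 1) (hS : ∀ g, MemX γ u₀ g → MemX γ u₀ (S g))
    (hSθ : ∀ g h C, MemX γ u₀ g → MemX γ u₀ h → (∀ x, u₀ ≤ x → x ^ γ * |g x - h x| ≤ C) →
      ∀ u, u₀ ≤ u → u ^ γ * |S g u - S h u| ≤ θ * C) :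
    ∃ g, MemX γ u₀ g ∧ ∀ u ∈ Set.Ici u₀, g u = S g u := by
  choose Φ hΦ using fun φ => (hS _ (memX_ofBCF (γ := γ) hu₀ φ)).exists_bcf hu₀
  have hcontr : ContractingWith ⟨θ, hθ0⟩ Φ := by
    refine ⟨by exact_mod_cast hθ, LipschitzWith.of_dist_le_mul fun φ ψ => ?_⟩
    refine (BoundedContinuousFunction.dist_le (by positivity)).2 fun x => ?_
    rw [hΦ, hΦ, Real.dist_eq, ← mul_sub, abs_mul,
      abs_of_nonneg (Real.rpow_nonneg (hu₀.le.trans x.2) _)]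
    refine hSθ _ _ _ (memX_ofBCF hu₀ φ) (memX_ofBCF hu₀ ψ) (fun y hy => ?_) x x.2
    rw [← abs_of_nonneg (Real.rpow_nonneg (hu₀.le.trans hy) γ), ← abs_mul, mul_sub, rpow_mul_ofBCF hu₀ φ ⟨y, hy⟩,
      rpow_mul_ofBCF hu₀ ψ ⟨y, hy⟩]
    exact BoundedContinuousFunction.dist_coe_le_dist (f := φ) (g := ψ) ⟨y, hy⟩
  refine ⟨ofBCF γ u₀ (ContractingWith.fixedPoint Φ hcontr), memX_ofBCF hu₀ _, fun u hu => ?_⟩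
  have hu : u₀ ≤ u := hu
  have h := hΦ (ContractingWith.fixedPoint Φ hcontr) ⟨u, hu⟩
  rw [hcontr.fixedPoint_isFixedPt, ← rpow_mul_ofBCF (γ := γ) hu₀] at h
  exact mul_left_cancel₀ (Real.rpow_pos_of_pos (hu₀.trans_le hu) γ).ne' h

theorem stmt17
    (Fbar : ℝ → ℝ) (μ α γ m : ℝ)
    (hμ : 0 < μ) (hα : 0 < α) (hγ : 0 < γ)
    (hF_anti : AntitoneOn Fbar (Set.Ici 0))
    (hF_mem : ∀ y ∈ Set.Ici (0 : ℝ), Fbar y ∈ Set.Icc (0 : ℝ) 1)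
    (hF_int : IntegrableOn Fbar (Set.Ioi 0))
    (hm : m = ∫ z in Set.Ioi (0 : ℝ), Fbar z)
    (u₀ : ℝ) (hu₀ : μ * m < u₀) (hu₀pos : 0 < u₀) :
    -- the contraction constant is < 1:
    μ * m / u₀ < 1 ∧
    -- S maps X into itself and is a contraction with constant μ m / u₀:
    (∀ g₁ g₂ : ℝ → ℝ, MemX γ u₀ g₁ → MemX γ u₀ g₂ →
      MemX γ u₀ (opS μ α γ Fbar g₁) ∧
      pnorm γ u₀ (fun x => opS μ α γ Fbar g₁ x - opS μ α γ Fbar g₂ x) ≤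
        μ * m / u₀ * pnorm γ u₀ (fun x => g₁ x - g₂ x)) ∧
    -- consequently there is a unique fixed point g* in X:
    (∃ gstar : ℝ → ℝ, MemX γ u₀ gstar ∧
      (∀ u ∈ Set.Ici u₀, gstar u = opS μ α γ Fbar gstar u) ∧
      (∀ h : ℝ → ℝ, MemX γ u₀ h → (∀ u ∈ Set.Ici u₀, h u = opS μ α γ Fbar h u) →
        ∀ u ∈ Set.Ici u₀, h u = gstar u)) := by
  subst hm
  have hF0 : ∀ y ∈ Set.Ici (0 : ℝ), 0 ≤ Fbar y := fun y hy => (hF_mem y hy).1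
  have hm0 : 0 ≤ ∫ z in Set.Ioi (0 : ℝ), Fbar z :=
    setIntegral_nonneg measurableSet_Ioi fun z hz => hF0 z (Set.Ioi_subset_Ici_self hz)
  have hθ : μ * (∫ z in Set.Ioi (0 : ℝ), Fbar z) / u₀ < 1 := (div_lt_one hu₀pos).2 hu₀
  have hS : ∀ g, MemX γ u₀ g → MemX γ u₀ (opS μ α γ Fbar g) := fun g hg =>
    memX_opS hμ hα hγ hu₀pos hF_int hF0 hg
  have hcontr : ∀ g h, MemX γ u₀ g → MemX γ u₀ h →
      pnorm γ u₀ (fun x => opS μ α γ Fbar g x - opS μ α γ Fbar h x) ≤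
        μ * (∫ z in Set.Ioi (0 : ℝ), Fbar z) / u₀ * pnorm γ u₀ (fun x => g x - h x) :=
    fun g h hg hh => pnorm_le fun u hu =>
      abs_opS_sub_opS_le hμ hα hγ hu₀pos hF_int hF0 hg hh
        (fun x hx => (hg.sub hu₀pos hh).le_pnorm hx) hu
  refine ⟨hθ, fun g h hg hh => ⟨hS g hg, hcontr g h hg hh⟩, ?_⟩
  obtain ⟨g, hg, hfix⟩ := exists_fixedPoint_of_weighted_contraction hu₀pos (by positivity) hθ hS
    fun g h C hg hh hC u hu => abs_opS_sub_opS_le hμ hα hγ hu₀pos hF_int hF0 hg hh hC hu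
  refine ⟨g, hg, hfix, fun h hh hhfix u hu => ?_⟩
  have hle : pnorm γ u₀ (fun x => h x - g x) ≤
      μ * (∫ z in Set.Ioi (0 : ℝ), Fbar z) / u₀ * pnorm γ u₀ (fun x => h x - g x) := by
    refine le_trans (le_of_eq ?_) (hcontr h g hh hg)
    simp only [pnorm]
    congr 1
    funext x
    rw [← hhfix x x.2, ← hfix x x.2]
  have hnonpos : pnorm γ u₀ (fun x => h x - g x) ≤ 0 := by nlinarith
  have hu0 : 0 < u ^ γ := Real.rpow_pos_of_pos (hu₀pos.trans_le hu) γ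
  have habs : |h u - g u| ≤ 0 :=
    nonpos_of_mul_nonpos_right (((hh.sub hu₀pos hg).le_pnorm hu).trans hnonpos) hu0
  exact sub_eq_zero.1 (abs_nonpos_iff.1 habs)
end
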